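/- Let d ≥ 1, 0 < p, q, r ≤ ∞, and let s(·) : Ω → (0,∞) be log-Hölder continuous with s_min := min_Ω s(·) > d(1/p − 1/r)_+. Let 𝐌 be the set of all B-splines M_{k,j}^d of a fixed degree m with sup_Ω s(·) < min{m, m−1+1/p} that do not vanish identically on Ω. Then for every ε > 0 there exists a constant C_ε > 0 such that for all N ∈ ℕ, N ≥ 1: σ_N(U_{B_{p,q}^{s(x)}(Ω)}, 𝐌)_{L^r(Ω)} ≥ C_ε N^{−(s_min+ε)/d}, where σ_N(W, 𝐌)_{L^r(Ω)} = sup_{f ∈ W} inf {‖f − Σ_{i=1}^N a_i φ_i‖_{L^r(Ω)} : a_1,…,a_N ∈ ℝ, φ_1,…,φ_N ∈ 𝐌}. -/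

import Mathlib

open MeasureTheory
open scoped ENNReal NNReal Classical

noncomputable section

abbrev Euc (d : ℕ) : Type := EuclideanSpace ℝ (Fin d)

/-- The unit cube `Ω = [0,1]^d`. -/
def unitCube (d : ℕ) : Set (Euc d) := {x | ∀ i, x i ∈ Set.Icc (0 : ℝ) 1}

/-- The axis-aligned cube `[c - t, c + t]^d`. -/
def cubeAt {d : ℕ} (c : Euc d) (t : ℝ) : Set (Euc d) := {x | ∀ i, |x i - c i| ≤ t}

/-- Lebesgue measure restricted to the unit cube `Ω`. -/
def cubeMeasure (d : ℕ) : Measure (Euc d) := volume.restrict (unitCube d)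

/-- `r`-th difference `Δ_h^r f (x) = Σ_{j=0}^r (−1)^{r−j} C(r,j) f(x+jh)`, set to `0`
unless both `x ∈ Ω` and `x + r h ∈ Ω`. -/
def rDiff {d : ℕ} (r : ℕ) (h : Euc d) (f : Euc d → ℝ) (x : Euc d) : ℝ :=
  if x ∈ unitCube d ∧ x + (r : ℝ) • h ∈ unitCube d then
    ∑ j ∈ Finset.range (r + 1), (-1 : ℝ) ^ (r - j) * (r.choose j : ℝ) * f (x + (j : ℝ) • h)
  else 0

/-- `ω*_{r,p}(f,t) = sup_{‖h‖₂ ≤ t} ‖ t^{−s(·)} Δ_h^r f ‖_{L^p(Ω)}`. -/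
def omegaStar {d : ℕ} (p : ℝ≥0∞) (σ : Euc d → ℝ) (r : ℕ) (f : Euc d → ℝ) (t : ℝ) : ℝ≥0∞ :=
  ⨆ h ∈ {h : Euc d | ‖h‖ ≤ t},
    eLpNorm (fun x => t ^ (-(σ x)) * rDiff r h f x) p (cubeMeasure d)

/-- Variable-exponent Besov seminorm `|f|_{B^{s(x)}_{p,q}(Ω)}` (difference order `r`):
`(∫_0^1 ω*_{r,p}(f,t)^q dt/t)^{1/q}` for `q < ∞`, and `sup_{t>0} ω*_{r,p}(f,t)` for `q = ∞`. -/
def vBesovSemi {d : ℕ} (p q : ℝ≥0∞) (σ : Euc d → ℝ) (r : ℕ) (f : Euc d → ℝ) : ℝ≥0∞ :=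
  if q = ∞ then ⨆ t ∈ Set.Ioi (0 : ℝ), omegaStar p σ r f t
  else (∫⁻ t in Set.Ioo (0 : ℝ) 1,
        (omegaStar p σ r f t) ^ q.toReal * ENNReal.ofReal (1 / t)) ^ (1 / q.toReal)

/-- Variable-exponent Besov (quasi-)norm with explicit difference order `r`:
`‖f‖ = ‖f‖_{L^p(Ω)} + |f|_{B^{s(x)}_{p,q}(Ω)}`. -/
def vBesovNormR {d : ℕ} (p q : ℝ≥0∞) (σ : Euc d → ℝ) (r : ℕ) (f : Euc d → ℝ) : ℝ≥0∞ :=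
  eLpNorm f p (cubeMeasure d) + vBesovSemi p q σ r f

/-- The canonical difference order `r = ⌊sup_Ω s(·)⌋ + 1`. -/
def besovR {d : ℕ} (σ : Euc d → ℝ) : ℕ := ⌊sSup (σ '' unitCube d)⌋₊ + 1

/-- Variable-exponent Besov (quasi-)norm `‖f‖_{B^{s(x)}_{p,q}(Ω)}` with the canonical
difference order `r = ⌊sup_Ω s(·)⌋ + 1`. -/
def vBesovNorm {d : ℕ} (p q : ℝ≥0∞) (σ : Euc d → ℝ) (f : Euc d → ℝ) : ℝ≥0∞ :=
  vBesovNormR p q σ (besovR σ) f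

/-- The unit ball `U_{B^{s(x)}_{p,q}(Ω)}`. -/
def vBesovUnitBall (d : ℕ) (p q : ℝ≥0∞) (σ : Euc d → ℝ) : Set (Euc d → ℝ) :=
  {f | vBesovNorm p q σ f ≤ 1}

/-- log-Hölder continuity on the unit cube: there exists `c_log > 0` with
`|σ x − σ y| ≤ c_log / log (e + 1/‖x−y‖₂)` for all `x ≠ y` in `Ω`. -/
def LogHolder {d : ℕ} (σ : Euc d → ℝ) : Prop :=
  ∃ c : ℝ, 0 < c ∧ ∀ x ∈ unitCube d, ∀ y ∈ unitCube d, x ≠ y →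
    |σ x - σ y| ≤ c / Real.log (Real.exp 1 + 1 / ‖x - y‖)

/-- Univariate cardinal B-spline of degree `m`. -/
def bspline (m : ℕ) (x : ℝ) : ℝ :=
  (m.factorial : ℝ)⁻¹ *
    ∑ j ∈ Finset.range (m + 2), (-1 : ℝ) ^ j * ((m + 1).choose j : ℝ) * max (x - j) 0 ^ m

/-- Tensor-product cardinal B-spline `M_{k,j}^d(x) = M_{0,0}^d(2^k x − j)`. -/
def Mspline (d m : ℕ) (k : ℕ) (j : Fin d → ℤ) (x : Euc d) : ℝ :=
  ∏ i, bspline m ((2 : ℝ) ^ k * x i - (j i : ℝ))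

/-- The dictionary `𝐌` of B-splines `M_{k,j}^d` of degree `m` not vanishing identically
on `Ω`. -/
def splineDict (d m : ℕ) : Set (Euc d → ℝ) :=
  {g | ∃ (k : ℕ) (j : Fin d → ℤ), g = Mspline d m k j ∧ ∃ x ∈ unitCube d, Mspline d m k j x ≠ 0}


lemma aux_diff_zero (m : ℕ) (a b : ℝ) :
    ∑ i ∈ Finset.range (m + 2), (-1 : ℝ) ^ i * ((m + 1).choose i : ℝ) * (a + b * i) ^ m = 0 := by
  have hP : ((Polynomial.C a + Polynomial.C b * Polynomial.X) ^ m : Polynomial ℝ).natDegree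
      < m + 1 := by
    refine Nat.lt_succ_of_le ((Polynomial.natDegree_pow_le).trans ?_)
    have : (Polynomial.C a + Polynomial.C b * Polynomial.X : Polynomial ℝ).natDegree ≤ 1 := by
      rw [add_comm]; exact Polynomial.natDegree_linear_le
    nlinarith
  have h := congrFun (Polynomial.fwdDiff_iter_eq_zero_of_degree_lt hP) 0
  rw [fwdDiff_iter_eq_sum_shift] at h
  have h2 : ∑ i ∈ Finset.range (m + 2), (-1 : ℝ) ^ i * ((m + 1).choose i : ℝ) * (a + b * i) ^ m
    = (-1 : ℝ) ^ (m + 1) * ∑ i ∈ Finset.range (m + 2),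
      (-1 : ℝ) ^ (m + 1 - i) * ((m + 1).choose i : ℝ) * (a + b * i) ^ m := by
    rw [Finset.mul_sum]
    refine Finset.sum_congr rfl fun i hi => ?_
    have hi' : i ≤ m + 1 := by have := Finset.mem_range.1 hi; omega
    obtain ⟨k, hk⟩ := Nat.exists_eq_add_of_le hi'
    rw [hk, Nat.add_sub_cancel_left, pow_add]
    have : (-1 : ℝ) ^ k * (-1 : ℝ) ^ k = 1 := by rw [← mul_pow]; simp
    linear_combination (-1 : ℝ) ^ i * ((i + k).choose i : ℝ) * (a + b * i) ^ m * (-this)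
  rw [h2]
  simp at h
  rw [h]; simp

lemma aux_bspline_nonpos {m : ℕ} (hm : 1 ≤ m) {x : ℝ} (hx : x ≤ 0) : bspline m x = 0 := by
  unfold bspline
  rw [Finset.sum_eq_zero, mul_zero]
  intro j _
  have : max (x - j) 0 = 0 := max_eq_right (by have : (0:ℝ) ≤ j := by positivity
                                               linarith)
  rw [this, zero_pow (by omega), mul_zero]

lemma aux_bspline_ge {m : ℕ} {x : ℝ} (hx : (m : ℝ) + 1 ≤ x) : bspline m x = 0 := by
  unfold bspline
  have : ∑ j ∈ Finset.range (m + 2), (-1 : ℝ) ^ j * ((m + 1).choose j : ℝ) * max (x - j) 0 ^ m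
     = ∑ j ∈ Finset.range (m + 2), (-1 : ℝ) ^ j * ((m + 1).choose j : ℝ) * (x + (-1) * j) ^ m := by
    refine Finset.sum_congr rfl fun j hj => ?_
    have : (j : ℝ) ≤ m + 1 := by
      have := Finset.mem_range.1 hj
      exact_mod_cast (by omega : j ≤ m + 1)
    rw [max_eq_left (by linarith)]; ring
  rw [this, aux_diff_zero, mul_zero]

lemma aux_bspline_diff {m : ℕ} (hm : 1 ≤ m) {k K : ℕ} (hk : k ≤ K) (l j : ℤ) (y h : ℝ) (hh : 0 ≤ h)
    (h1 : (l : ℝ) ≤ 2 ^ K * y) (h2 : 2 ^ K * (y + (m + 1) * h) ≤ l + 1) :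
    ∑ i ∈ Finset.range (m + 2), (-1 : ℝ) ^ i * ((m + 1).choose i : ℝ) *
      bspline m (2 ^ k * (y + i * h) - j) = 0 := by
  unfold bspline
  simp_rw [Finset.mul_sum]
  rw [Finset.sum_comm]
  refine Finset.sum_eq_zero fun j' _ => ?_
  have key : ∑ i ∈ Finset.range (m + 2), (-1 : ℝ) ^ i * ((m + 1).choose i : ℝ) *
      max (2 ^ k * (y + i * h) - j - j') 0 ^ m = 0 := by
    obtain ⟨e, rfl⟩ := Nat.exists_eq_add_of_le hk
    have hi : ∀ i ∈ Finset.range (m + 2), (i : ℝ) * h ≤ (m + 1) * h := fun i hi => by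
      have := Finset.mem_range.1 hi
      have : (i : ℝ) ≤ m + 1 := by exact_mod_cast (by omega : i ≤ m + 1)
      exact mul_le_mul_of_nonneg_right this hh
    have he : (0 : ℝ) < 2 ^ e := by positivity
    have hK : (0 : ℝ) < 2 ^ (k + e) := by positivity
    by_cases hc : (j + j') * 2 ^ e ≤ l
    · have hc' : ((j : ℝ) + j') * 2 ^ e ≤ l := by exact_mod_cast hc
      refine Eq.trans ?_ (aux_diff_zero m (2 ^ k * y - j - j') (2 ^ k * h))
      refine Finset.sum_congr rfl fun i _ => ?_
      rw [max_eq_left]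
      · ring
      · have h0 : (0 : ℝ) ≤ i * h := by positivity
        have : ((j : ℝ) + j') * 2 ^ e ≤ (2 ^ k * (y + i * h)) * 2 ^ e := by
          calc _ ≤ 2 ^ (k + e) * y := hc'.trans h1
            _ ≤ 2 ^ (k + e) * (y + i * h) := by gcongr; linarith
            _ = _ := by rw [pow_add]; ring
        have := le_of_mul_le_mul_right this he
        linarith
    · have hc' : (l : ℝ) + 1 ≤ ((j : ℝ) + j') * 2 ^ e := by
        exact_mod_cast (by omega : l + 1 ≤ (j + j') * 2 ^ e)
      refine Finset.sum_eq_zero fun i hi' => ?_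
      rw [max_eq_right, zero_pow (by omega), mul_zero]
      have : (2 ^ k * (y + i * h)) * 2 ^ e ≤ ((j : ℝ) + j') * 2 ^ e := by
          calc _ = 2 ^ (k + e) * (y + i * h) := by rw [pow_add]; ring
            _ ≤ 2 ^ (k + e) * (y + (m + 1) * h) := by gcongr 2 ^ (k + e) * (y + ?_); exact hi i hi'
            _ ≤ _ := h2.trans hc'
      have := le_of_mul_le_mul_right this he
      linarith
  calc _ = (m.factorial : ℝ)⁻¹ * ((-1) ^ j' * ((m + 1).choose j' : ℝ)) *
      ∑ i ∈ Finset.range (m + 2), (-1 : ℝ) ^ i * ((m + 1).choose i : ℝ) *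
      max (2 ^ k * (y + i * h) - j - j') 0 ^ m := by
        rw [Finset.mul_sum]; refine Finset.sum_congr rfl fun i _ => ?_; ring
    _ = 0 := by rw [key, mul_zero]

lemma aux_fwdDiff_bound {E : Type} [NormedAddCommGroup E] [NormedSpace ℝ E] (n : ℕ) :
    ∀ {F : Type} [NormedAddCommGroup F] [NormedSpace ℝ F] (f : E → F) (M : ℝ),
      ContDiff ℝ n f → (∀ x, ‖iteratedFDeriv ℝ n f x‖ ≤ M) → ∀ h x,
      ‖(fwdDiff h)^[n] f x‖ ≤ M * ‖h‖ ^ n := by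
  induction n with
  | zero =>
    intro F _ _ f M _ hM h x
    simpa using hM x
  | succ n ih =>
    intro F _ _ f M hf hM h x
    rw [Function.iterate_succ_apply']
    have hf' : ContDiff ℝ n (fderiv ℝ f) := hf.fderiv_right (by norm_cast)
    have hd : Differentiable ℝ f := hf.differentiable (by norm_cast)
    have hD : ∀ y, HasFDerivAt ((fwdDiff h)^[n] f) ((fwdDiff h)^[n] (fderiv ℝ f) y) y := by
      have : ∀ (g : E → F) (g' : E → E →L[ℝ] F), (∀ y, HasFDerivAt g (g' y) y) →
          ∀ k : ℕ, ∀ y, HasFDerivAt ((fwdDiff h)^[k] g) ((fwdDiff h)^[k] g' y) y := by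
        intro g g' hg k
        induction k with
        | zero => simpa using hg
        | succ k ihk =>
          intro y
          rw [Function.iterate_succ_apply', Function.iterate_succ_apply']
          exact ((hasFDerivAt_comp_add_right h).2 (ihk (y + h))).sub (ihk y)
      exact this f _ (fun y => (hd y).hasFDerivAt) n
    have hb := ih (fderiv ℝ f) M hf' (fun x => by
      rw [norm_iteratedFDeriv_fderiv]; exact hM x) h
    have := Convex.norm_image_sub_le_of_norm_hasFDerivWithin_le (s := Set.univ)
      (fun y _ => (hD y).hasFDerivWithinAt) (fun y _ => hb y) convex_univ
      (Set.mem_univ x) (Set.mem_univ (x + h))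
    unfold fwdDiff at *
    refine this.trans (le_of_eq ?_)
    rw [add_sub_cancel_left, pow_succ]; ring

lemma aux_rDiff_eq {d : ℕ} (n : ℕ) (h : Euc d) (f : Euc d → ℝ) (x : Euc d) :
    ∑ j ∈ Finset.range (n + 1), (-1 : ℝ) ^ (n - j) * (n.choose j : ℝ) * f (x + (j : ℝ) • h)
      = (fwdDiff h)^[n] f x := by
  rw [fwdDiff_iter_eq_sum_shift]
  refine Finset.sum_congr rfl fun j _ => ?_
  simp [Nat.cast_smul_eq_nsmul]

/-- The oscillating test function. -/
def testFn {d : ℕ} (i0 : Fin d) {x0 : Euc d} (χ : ContDiffBump x0) (w : ℝ) (x : Euc d) : ℝ :=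
  χ x * Real.cos (w * x i0)

lemma aux_test_deriv {d : ℕ} (i0 : Fin d) {x0 : Euc d} (χ : ContDiffBump x0) (R : ℕ) :
    ∃ C : ℝ, 0 ≤ C ∧ ∀ w : ℝ, 1 ≤ w → ∀ h x,
      |(fwdDiff h)^[R] (testFn i0 χ w) x| ≤ C * w ^ R * ‖h‖ ^ R := by
  have hb : ∀ i : ℕ, ∃ C : ℝ, ∀ x, ‖iteratedFDeriv ℝ i χ x‖ ≤ C := by
    intro i
    have hc : Continuous (iteratedFDeriv ℝ i χ) :=
      (χ.contDiff (n := ⊤)).continuous_iteratedFDeriv (by exact_mod_cast le_top)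
    obtain ⟨C, hC⟩ := (χ.hasCompactSupport.iteratedFDeriv (𝕜 := ℝ) i).exists_bound_of_continuous hc
    exact ⟨C, hC⟩
  choose B hB using hb
  have hB0 : ∀ i, 0 ≤ B i := fun i => (norm_nonneg _).trans (hB i x0)
  refine ⟨∑ i ∈ Finset.range (R + 1), (R.choose i : ℝ) * B i,
    Finset.sum_nonneg fun i _ => mul_nonneg (by positivity) (hB0 i), ?_⟩
  intro w hw h x
  have hL : ∃ L : Euc d →L[ℝ] ℝ, (∀ x, L x = w * x i0) ∧ ‖L‖ ≤ w := by
    refine ⟨w • EuclideanSpace.proj i0, fun x => by simp, ?_⟩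
    refine ContinuousLinearMap.opNorm_le_bound _ (by linarith) fun y => ?_
    simp only [_root_.smul_apply, norm_smul]
    rw [Real.norm_of_nonneg (by linarith)]
    have := EuclideanSpace.norm_eq y
    gcongr
    exact PiLp.norm_apply_le y i0
  obtain ⟨L, hL1, hL2⟩ := hL
  have hcos : ∀ (i : ℕ) x, ‖iteratedFDeriv ℝ i (fun x : Euc d => Real.cos (w * x i0)) x‖ ≤ w ^ i := by
    intro i x
    have he : (fun x : Euc d => Real.cos (w * x i0)) = Real.cos ∘ L := by
      ext x; simp [hL1]
    rw [he, L.iteratedFDeriv_comp_right (Real.contDiff_cos (n := i)) x (le_refl _)]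
    refine (ContinuousMultilinearMap.norm_compContinuousLinearMap_le _ _).trans ?_
    rw [norm_iteratedFDeriv_eq_norm_iteratedDeriv, Finset.prod_const, Finset.card_univ,
      Fintype.card_fin, Real.norm_eq_abs]
    calc _ ≤ 1 * ‖L‖ ^ i := by gcongr; exact Real.abs_iteratedDeriv_cos_le_one i _
      _ ≤ w ^ i := by rw [one_mul]; gcongr
  have hcd : ContDiff ℝ R (fun x : Euc d => Real.cos (w * x i0)) := by fun_prop
  have := aux_fwdDiff_bound R (testFn i0 χ w)
    ((∑ i ∈ Finset.range (R + 1), (R.choose i : ℝ) * B i) * w ^ R)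
    (χ.contDiff.mul hcd) (fun y => ?_) h x
  · simpa using this
  · refine (norm_iteratedFDeriv_mul_le (N := R) χ.contDiff hcd y (le_refl _)).trans ?_
    rw [Finset.sum_mul]
    refine Finset.sum_le_sum fun i hi => ?_
    gcongr
    · exact mul_nonneg (by positivity) (hB0 i)
    · exact hB i y
    · refine (hcos _ y).trans (pow_le_pow_right₀ hw (by omega))

lemma aux_fwdDiff_le_two_pow {E : Type} [AddCommGroup E] (n : ℕ) (f : E → ℝ)
    (hf : ∀ x, |f x| ≤ 1) (h x : E) : |(fwdDiff h)^[n] f x| ≤ 2 ^ n := by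
  induction n generalizing x with
  | zero => simpa using hf x
  | succ n ih =>
    rw [Function.iterate_succ_apply']
    unfold fwdDiff at *
    have h1 := ih (x + h)
    have h2 := ih x
    rw [abs_le] at *
    constructor <;> rw [pow_succ] <;> linarith

lemma aux_pointwise {d : ℕ} (σ : Euc d → ℝ) (x0 : Euc d) (R : ℕ) (hR : 1 ≤ R)
    (α η δ S C1 : ℝ) (hα : 0 < α) (hαR : α ≤ R) (hη : 0 < η) (hδ : 0 < δ) (hC1 : 0 ≤ C1)
    (hσ : ∀ x ∈ unitCube d, 0 ≤ σ x ∧ σ x ≤ S)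
    (hσδ : ∀ x ∈ unitCube d, ‖x - x0‖ < δ → σ x ≤ α - η) :
    ∃ C3 : ℝ, 0 < C3 ∧ ∀ w : ℝ, 1 ≤ w → ∀ f : Euc d → ℝ, (∀ x, |f x| ≤ 1) →
      (∀ x, f x ≠ 0 → ‖x - x0‖ < δ / 2) →
      (∀ h x, |(fwdDiff h)^[R] f x| ≤ C1 * w ^ R * ‖h‖ ^ R) →
      ∀ t : ℝ, 0 < t → ∀ h : Euc d, ‖h‖ ≤ t → ∀ x,
        |t ^ (-(σ x)) * (w ^ (-α) * rDiff R h f x)| ≤ C3 * (min t 1) ^ η := by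
  have hR' : (0 : ℝ) < R := by exact_mod_cast hR
  set t0 : ℝ := min 1 (δ / (2 * R)) with ht0
  have ht0p : 0 < t0 := lt_min one_pos (by positivity)
  set C2 : ℝ := 2 ^ R + C1 with hC2
  have hC2p : 0 < C2 := by positivity
  refine ⟨C2 * (1 + t0 ^ (-S) * t0 ^ (-η)), by positivity, ?_⟩
  intro w hw f hf1 hf2 hf3 t ht h hh x
  have hw0 : 0 < w := by linarith
  by_cases hz : rDiff R h f x = 0
  · rw [hz]; simp; positivity
  have hxΩ : x ∈ unitCube d ∧ x + (R : ℝ) • h ∈ unitCube d := by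
    by_contra hc
    exact hz (by unfold rDiff; rw [if_neg hc])
  have hval : rDiff R h f x = (fwdDiff h)^[R] f x := by
    rw [← aux_rDiff_eq]; unfold rDiff; rw [if_pos hxΩ]
  have hnear : ‖x - x0‖ < δ / 2 + R * t := by
    have : ∃ j ∈ Finset.range (R + 1), f (x + (j : ℝ) • h) ≠ 0 := by
      by_contra hc
      push Not at hc
      apply hz
      rw [hval, ← aux_rDiff_eq]
      exact Finset.sum_eq_zero fun j hj => by rw [hc j hj, mul_zero]
    obtain ⟨j, hj, hj2⟩ := this
    have h1 := hf2 _ hj2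
    have hj' : (j : ℝ) ≤ R := by
      have := Finset.mem_range.1 hj
      exact_mod_cast (by omega : j ≤ R)
    have h2 : ‖(j : ℝ) • h‖ ≤ R * t := by
      rw [norm_smul, Real.norm_of_nonneg (by positivity)]
      gcongr
    calc ‖x - x0‖ = ‖(x + (j : ℝ) • h - x0) - (j : ℝ) • h‖ := by congr 1; abel
      _ ≤ ‖x + (j : ℝ) • h - x0‖ + ‖(j : ℝ) • h‖ := norm_sub_le _ _
      _ < _ := by linarith
  set D : ℝ := |(fwdDiff h)^[R] f x| with hD
  have hD0 : 0 ≤ D := abs_nonneg _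
  have hD1 : D ≤ 2 ^ R := aux_fwdDiff_le_two_pow R f hf1 h x
  have hD2 : D ≤ C2 * (w * t) ^ α := by
    have hwt : 0 < w * t := by positivity
    rcases le_total (w * t) 1 with hle | hge
    · have h1 : D ≤ C1 * (w * t) ^ R := by
        refine (hf3 h x).trans ?_
        rw [mul_pow, ← mul_assoc]; gcongr
      have h2 : (w * t) ^ R ≤ (w * t) ^ α := by
        rw [← Real.rpow_natCast]
        exact Real.rpow_le_rpow_of_exponent_ge hwt hle hαR
      refine h1.trans ?_
      have : C1 ≤ C2 := by rw [hC2]; linarith [pow_pos (zero_lt_two (α := ℝ)) R]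
      gcongr
    · have h2 : 1 ≤ (w * t) ^ α := Real.one_le_rpow hge hα.le
      have : (2:ℝ) ^ R ≤ C2 := by rw [hC2]; linarith
      nlinarith
  have hE2 : w ^ (-α) * D ≤ C2 * t ^ α := by
    calc w ^ (-α) * D ≤ w ^ (-α) * (C2 * (w * t) ^ α) := by gcongr
      _ = C2 * t ^ α * (w ^ (-α) * w ^ α) := by
        rw [Real.mul_rpow hw0.le ht.le]; ring
      _ = _ := by rw [← Real.rpow_add hw0]; simp
  have hE1 : w ^ (-α) * D ≤ C2 := by
    have : w ^ (-α) ≤ 1 := Real.rpow_le_one_of_one_le_of_nonpos hw (by linarith)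
    calc w ^ (-α) * D ≤ 1 * D := by gcongr
      _ ≤ C2 := by rw [hC2]; linarith
  have habs : |t ^ (-(σ x)) * (w ^ (-α) * rDiff R h f x)| = t ^ (-(σ x)) * (w ^ (-α) * D) := by
    rw [abs_mul, abs_mul, hval, abs_of_pos (Real.rpow_pos_of_pos ht _),
      abs_of_pos (Real.rpow_pos_of_pos hw0 _)]
  rw [habs]
  have hE0 : 0 ≤ w ^ (-α) * D := by positivity
  obtain ⟨hσ0, hσS⟩ := hσ x hxΩ.1
  have hpos : 0 < t0 ^ (-S) * t0 ^ (-η) := by positivity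
  rcases le_total t t0 with hA | hA
  · have ht1 : t ≤ 1 := hA.trans (min_le_left _ _)
    have hb : R * t ≤ δ / 2 := by
      have : t ≤ δ / (2 * R) := hA.trans (min_le_right _ _)
      calc R * t ≤ R * (δ / (2 * R)) := by gcongr
        _ = δ / 2 := by field_simp
    have hs := hσδ x hxΩ.1 (by linarith)
    rw [min_eq_left ht1]
    calc t ^ (-(σ x)) * (w ^ (-α) * D) ≤ t ^ (-(α - η)) * (C2 * t ^ α) := by
          refine mul_le_mul ?_ hE2 hE0 (by positivity)
          exact Real.rpow_le_rpow_of_exponent_ge ht ht1 (by linarith)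
      _ = C2 * t ^ η := by
          rw [mul_left_comm, ← Real.rpow_add ht]; congr 2; ring
      _ ≤ C2 * (1 + t0 ^ (-S) * t0 ^ (-η)) * t ^ η := by
          gcongr
          nlinarith
  · rcases le_total t 1 with hB | hB
    · rw [min_eq_left hB]
      calc t ^ (-(σ x)) * (w ^ (-α) * D) ≤ t0 ^ (-S) * C2 := by
            refine mul_le_mul ?_ hE1 hE0 (by positivity)
            calc t ^ (-(σ x)) ≤ t ^ (-S) :=
                  Real.rpow_le_rpow_of_exponent_ge ht hB (by linarith)
              _ ≤ t0 ^ (-S) := Real.rpow_le_rpow_of_nonpos ht0p hA (by linarith)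
        _ = C2 * (t0 ^ (-S) * t0 ^ (-η)) * t0 ^ η := by
            have : t0 ^ (-η) * t0 ^ η = 1 := by rw [← Real.rpow_add ht0p]; simp
            linear_combination (-(t0 ^ (-S) * C2)) * this
        _ ≤ C2 * (1 + t0 ^ (-S) * t0 ^ (-η)) * t ^ η := by
            gcongr
            linarith
    · rw [min_eq_right hB, Real.one_rpow, mul_one]
      have : t ^ (-(σ x)) ≤ 1 := Real.rpow_le_one_of_one_le_of_nonpos hB (by linarith)
      calc t ^ (-(σ x)) * (w ^ (-α) * D) ≤ 1 * C2 := mul_le_mul this hE1 hE0 zero_le_one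
        _ ≤ _ := by nlinarith

/-- A half-open box. -/
def hbox {d : ℕ} (c w : Fin d → ℝ) : Set (Euc d) := {x | ∀ i, c i ≤ x i ∧ x i < c i + w i}

lemma aux_hbox_eq {d : ℕ} (c w : Fin d → ℝ) : hbox c w =
    (WithLp.ofLp : Euc d → (Fin d → ℝ)) ⁻¹' (Set.univ.pi fun i => Set.Ico (c i) (c i + w i)) := by
  ext x; simp [hbox]

lemma aux_hbox_meas {d : ℕ} (c w : Fin d → ℝ) : MeasurableSet (hbox c w) := by
  rw [aux_hbox_eq]
  exact (PiLp.volume_preserving_ofLp (Fin d)).measurable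
    (MeasurableSet.univ_pi fun i => measurableSet_Ico)

lemma aux_hbox_vol {d : ℕ} (c w : Fin d → ℝ) :
    volume (hbox c w) = ∏ i, ENNReal.ofReal (w i) := by
  rw [aux_hbox_eq, (PiLp.volume_preserving_ofLp (Fin d)).measure_preimage
    (MeasurableSet.univ_pi fun i => measurableSet_Ico).nullMeasurableSet, Real.volume_pi_Ico]
  simp

lemma aux_cube_meas (d : ℕ) : MeasurableSet (unitCube d) := by
  have : unitCube d = (WithLp.ofLp : Euc d → (Fin d → ℝ)) ⁻¹'
      (Set.univ.pi fun _ => Set.Icc (0 : ℝ) 1) := by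
    ext x; simp [unitCube, Pi.le_def, forall_and]
  rw [this]
  exact (PiLp.volume_preserving_ofLp (Fin d)).measurable
    (MeasurableSet.univ_pi fun i => measurableSet_Icc)

instance aux_cube_prob (d : ℕ) : IsProbabilityMeasure (cubeMeasure d) := by
  constructor
  have : unitCube d = (WithLp.ofLp : Euc d → (Fin d → ℝ)) ⁻¹'
      (Set.univ.pi fun _ => Set.Icc (0 : ℝ) 1) := by
    ext x; simp [unitCube, Pi.le_def, forall_and]
  unfold cubeMeasure
  rw [Measure.restrict_apply_univ, this, (PiLp.volume_preserving_ofLp (Fin d)).measure_preimage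
    (MeasurableSet.univ_pi fun i => measurableSet_Icc).nullMeasurableSet, volume_pi_pi]
  simp

lemma aux_eLp_le {d : ℕ} (p : ℝ≥0∞) (f : Euc d → ℝ) (C : ℝ) (hf : ∀ x, |f x| ≤ C) :
    eLpNorm f p (cubeMeasure d) ≤ ENNReal.ofReal C := by
  refine (eLpNorm_le_of_ae_bound (C := C) (ae_of_all _ hf)).trans ?_
  simp

lemma aux_besov {d : ℕ} (p q : ℝ≥0∞) (hq : 0 < q) (σ : Euc d → ℝ) (x0 : Euc d)
    (R : ℕ) (hR : 1 ≤ R)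
    (α η δ S C1 : ℝ) (hα : 0 < α) (hαR : α ≤ R) (hη : 0 < η) (hδ : 0 < δ) (hC1 : 0 ≤ C1)
    (hσ : ∀ x ∈ unitCube d, 0 ≤ σ x ∧ σ x ≤ S)
    (hσδ : ∀ x ∈ unitCube d, ‖x - x0‖ < δ → σ x ≤ α - η) :
    ∃ c0 : ℝ, 0 < c0 ∧ ∀ w : ℝ, 1 ≤ w → ∀ f : Euc d → ℝ, (∀ x, |f x| ≤ 1) →
      (∀ x, f x ≠ 0 → ‖x - x0‖ < δ / 2) →
      (∀ h x, |(fwdDiff h)^[R] f x| ≤ C1 * w ^ R * ‖h‖ ^ R) →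
      vBesovNormR p q σ R (fun x => c0 * w ^ (-α) * f x) ≤ 1 := by
  obtain ⟨C3, hC3, hpt⟩ := aux_pointwise σ x0 R hR α η δ S C1 hα hαR hη hδ hC1 hσ hσδ
  set I : ℝ≥0∞ := ∫⁻ t in Set.Ioo (0 : ℝ) 1, ENNReal.ofReal (t ^ (η * q.toReal - 1)) with hI
  have hIfin : q ≠ ∞ → I ≠ ∞ := by
    intro hqt
    have hq' : 0 < q.toReal := ENNReal.toReal_pos hq.ne' hqt
    have : IntegrableOn (fun t : ℝ => t ^ (η * q.toReal - 1)) (Set.Ioo 0 1) :=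
      (intervalIntegral.integrableOn_Ioo_rpow_iff one_pos).2 (by nlinarith [mul_pos hη hq'])
    exact (Integrable.lintegral_lt_top this).ne
  set J : ℝ := (I ^ (1 / q.toReal)).toReal with hJ
  have hJ0 : 0 ≤ J := ENNReal.toReal_nonneg
  set c0 : ℝ := 1 / (1 + C3 + C3 * J) with hc0
  have hc0p : 0 < c0 := by positivity
  refine ⟨c0, hc0p, ?_⟩
  intro w hw f hf1 hf2 hf3
  have hw0 : 0 < w := by linarith
  have homega : ∀ t : ℝ, 0 < t → omegaStar p σ R (fun x => c0 * w ^ (-α) * f x) t ≤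
      ENNReal.ofReal (c0 * C3 * (min t 1) ^ η) := by
    intro t ht
    unfold omegaStar
    refine iSup₂_le fun h hh => ?_
    refine aux_eLp_le p _ _ fun x => ?_
    have hlin : rDiff R h (fun x => c0 * w ^ (-α) * f x) x = c0 * w ^ (-α) * rDiff R h f x := by
      unfold rDiff
      split_ifs
      · rw [Finset.mul_sum]; refine Finset.sum_congr rfl fun j _ => ?_; ring
      · simp
    rw [hlin]
    have := hpt w hw f hf1 hf2 hf3 t ht h hh x
    calc |t ^ (-(σ x)) * (c0 * w ^ (-α) * rDiff R h f x)|
        = c0 * |t ^ (-(σ x)) * (w ^ (-α) * rDiff R h f x)| := by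
          rw [← abs_of_pos hc0p, ← abs_mul, abs_of_pos hc0p]; congr 1; ring
      _ ≤ c0 * (C3 * (min t 1) ^ η) := by gcongr
      _ = _ := by ring
  have hLp : eLpNorm (fun x => c0 * w ^ (-α) * f x) p (cubeMeasure d) ≤ ENNReal.ofReal c0 := by
    refine aux_eLp_le p _ _ fun x => ?_
    have h1 : w ^ (-α) ≤ 1 := Real.rpow_le_one_of_one_le_of_nonpos hw (by linarith)
    rw [abs_mul, abs_of_pos (by positivity)]
    calc _ ≤ c0 * 1 * 1 := by gcongr; exact hf1 x
      _ = c0 := by ring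
  have hsemi : vBesovSemi p q σ R (fun x => c0 * w ^ (-α) * f x) ≤
      ENNReal.ofReal (c0 * (C3 + C3 * J)) := by
    unfold vBesovSemi
    split_ifs with hqt
    · refine iSup₂_le fun t ht => (homega t ht).trans ?_
      refine ENNReal.ofReal_le_ofReal ?_
      have ht' : (0:ℝ) < t := ht
      have hm : (min t 1) ^ η ≤ 1 :=
        Real.rpow_le_one (le_min ht'.le zero_le_one) (min_le_right _ _) hη.le
      calc c0 * C3 * (min t 1) ^ η ≤ c0 * C3 * 1 := by gcongr
        _ ≤ _ := by nlinarith [mul_nonneg (mul_nonneg hc0p.le hC3.le) hJ0]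
    · have hq' : 0 < q.toReal := ENNReal.toReal_pos hq.ne' hqt
      have hint : ∫⁻ t in Set.Ioo (0 : ℝ) 1,
          (omegaStar p σ R (fun x => c0 * w ^ (-α) * f x) t) ^ q.toReal * ENNReal.ofReal (1 / t)
          ≤ ENNReal.ofReal (c0 * C3) ^ q.toReal * I := by
        rw [hI, ← lintegral_const_mul' _ _ (by simp)]
        refine setLIntegral_mono' measurableSet_Ioo fun t ht => ?_
        have h1 := homega t ht.1
        rw [min_eq_left ht.2.le] at h1
        calc _ ≤ ENNReal.ofReal (c0 * C3 * t ^ η) ^ q.toReal * ENNReal.ofReal (1 / t) := by gcongr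
          _ = _ := by
            have ht0 : 0 < t := ht.1
            rw [ENNReal.ofReal_mul (by positivity), ENNReal.mul_rpow_of_nonneg _ _ hq'.le,
              mul_assoc]
            congr 1
            rw [ENNReal.ofReal_rpow_of_nonneg (by positivity) hq'.le, ← ENNReal.ofReal_mul (by positivity)]
            congr 1
            rw [← Real.rpow_mul ht0.le, Real.rpow_sub_one ht0.ne']
            ring
      calc _ ≤ (ENNReal.ofReal (c0 * C3) ^ q.toReal * I) ^ (1 / q.toReal) := by gcongr
        _ = ENNReal.ofReal (c0 * C3) * I ^ (1 / q.toReal) := by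
          rw [ENNReal.mul_rpow_of_nonneg _ _ (by positivity), ← ENNReal.rpow_mul,
            mul_one_div_cancel hq'.ne', ENNReal.rpow_one]
        _ = ENNReal.ofReal (c0 * C3 * J) := by
          rw [ENNReal.ofReal_mul (p := c0 * C3) (by positivity), hJ, ENNReal.ofReal_toReal]
          exact ENNReal.rpow_ne_top_of_nonneg (by positivity) (hIfin hqt)
        _ ≤ _ := by
          refine ENNReal.ofReal_le_ofReal ?_
          nlinarith
  unfold vBesovNormR
  calc _ ≤ ENNReal.ofReal c0 + ENNReal.ofReal (c0 * (C3 + C3 * J)) := add_le_add hLp hsemi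
    _ = ENNReal.ofReal (c0 + c0 * (C3 + C3 * J)) := by
      rw [ENNReal.ofReal_add hc0p.le (by positivity)]
    _ = 1 := by
      rw [← ENNReal.ofReal_one]; congr 1
      rw [hc0]; field_simp; ring

lemma aux_eLp_ge {d : ℕ} (r : ℝ≥0∞) (hr : 0 < r) (β : ℝ) (hβ : 0 < β) :
    ∃ κ : ℝ, 0 < κ ∧ ∀ (A : ℝ) (F : Euc d → ℝ), 0 < A →
      AEStronglyMeasurable F (cubeMeasure d) →
      ENNReal.ofReal β ≤ cubeMeasure d {x | A ≤ |F x|} →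
      ENNReal.ofReal (A * κ) ≤ eLpNorm F r (cubeMeasure d) := by
  have main : ∀ r : ℝ≥0∞, 0 < r → r ≠ ∞ →
      ∃ κ : ℝ, 0 < κ ∧ ∀ (A : ℝ) (F : Euc d → ℝ), 0 < A →
      AEStronglyMeasurable F (cubeMeasure d) →
      ENNReal.ofReal β ≤ cubeMeasure d {x | A ≤ |F x|} →
      ENNReal.ofReal (A * κ) ≤ eLpNorm F r (cubeMeasure d) := by
    intro r hr hrt
    have hr' : 0 < r.toReal := ENNReal.toReal_pos hr.ne' hrt
    refine ⟨β ^ (1 / r.toReal), by positivity, ?_⟩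
    intro A F hA hF hB
    have h := mul_meas_ge_le_pow_eLpNorm' (cubeMeasure d) hr.ne' hrt hF (ENNReal.ofReal A)
    have hset : {x | ENNReal.ofReal A ≤ ‖F x‖ₑ} = {x | A ≤ |F x|} := by
      ext x
      simp only [Set.mem_ofPred_eq]
      rw [Real.enorm_eq_ofReal_abs, ENNReal.ofReal_le_ofReal_iff (abs_nonneg _)]
    rw [hset] at h
    have h2 : ENNReal.ofReal (A * β ^ (1 / r.toReal)) ^ r.toReal
        ≤ eLpNorm F r (cubeMeasure d) ^ r.toReal := by
      refine le_trans (le_of_eq ?_) ((mul_le_mul_right hB (ENNReal.ofReal A ^ r.toReal)).trans h)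
      rw [ENNReal.ofReal_mul hA.le, ENNReal.mul_rpow_of_nonneg _ _ hr'.le]
      congr 1
      rw [ENNReal.ofReal_rpow_of_nonneg (by positivity) hr'.le, ← Real.rpow_mul hβ.le,
        one_div_mul_cancel hr'.ne', Real.rpow_one]
    exact (ENNReal.rpow_le_rpow_iff hr').1 h2
  by_cases hrt : r = ∞
  · obtain ⟨κ, hκ, h⟩ := main 1 one_pos (by simp)
    refine ⟨κ, hκ, fun A F hA hF hB => (h A F hA hF hB).trans ?_⟩
    exact eLpNorm_le_eLpNorm_of_exponent_le (by rw [hrt]; exact le_top) hF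
  · exact main r hr hrt

lemma aux_shift {d : ℕ} (E B : Set (Euc d)) (M : ℕ) (u : ℕ → Euc d)
    (h : ∀ x ∈ E, ∃ s < M, x + u s ∈ B) : volume E ≤ M * volume B := by
  have hsub : E ⊆ ⋃ s ∈ Finset.range M, (fun x => x + u s) ⁻¹' B := by
    intro x hx
    obtain ⟨s, hs, hxs⟩ := h x hx
    simp only [Set.mem_iUnion]
    exact ⟨s, Finset.mem_range.2 hs, hxs⟩
  refine (measure_mono hsub).trans ((measure_biUnion_finset_le _ _).trans ?_)
  simp [measure_preimage_add_right]

lemma aux_add_single {d : ℕ} (i0 : Fin d) (x : Euc d) (τ : ℝ) (i : Fin d) :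
    (x + τ • EuclideanSpace.single i0 (1 : ℝ)) i = if i = i0 then x i + τ else x i := by
  split_ifs with h
  · subst h; simp
  · simp [h]

lemma aux_M_diff {d m : ℕ} (hm : 1 ≤ m) (i0 : Fin d) {k K : ℕ} (hk : k ≤ K) (l : ℤ)
    (j : Fin d → ℤ) (x : Euc d) (h : ℝ) (hh : 0 ≤ h)
    (h1 : (l : ℝ) ≤ 2 ^ K * x i0) (h2 : 2 ^ K * (x i0 + (m + 1) * h) ≤ l + 1) :
    ∑ i ∈ Finset.range (m + 2), (-1 : ℝ) ^ i * ((m + 1).choose i : ℝ) *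
      Mspline d m k j (x + ((i : ℝ) * h) • EuclideanSpace.single i0 (1 : ℝ)) = 0 := by
  have hM : ∀ τ : ℝ, Mspline d m k j (x + τ • EuclideanSpace.single i0 (1 : ℝ)) =
      bspline m (2 ^ k * (x i0 + τ) - j i0) *
        ∏ i ∈ Finset.univ.erase i0, bspline m (2 ^ k * x i - j i) := by
    intro τ
    unfold Mspline
    rw [← Finset.mul_prod_erase _ _ (Finset.mem_univ i0), aux_add_single, if_pos rfl]
    congr 1
    refine Finset.prod_congr rfl fun i hi => ?_
    rw [aux_add_single, if_neg (Finset.ne_of_mem_erase hi)]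
  simp_rw [hM, ← mul_assoc]
  rw [← Finset.sum_mul, aux_bspline_diff hm hk l (j i0) (x i0) h hh h1 h2, zero_mul]

lemma aux_M_support {d m : ℕ} (hm : 1 ≤ m) (k : ℕ) (j : Fin d → ℤ) (x : Euc d)
    (hx : Mspline d m k j x ≠ 0) (i : Fin d) :
    0 < 2 ^ k * x i - j i ∧ 2 ^ k * x i - j i < (m : ℝ) + 1 := by
  have h : bspline m (2 ^ k * x i - j i) ≠ 0 := by
    unfold Mspline at hx
    exact Finset.prod_ne_zero_iff.1 hx i (Finset.mem_univ i)
  constructor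
  · by_contra hc
    exact h (aux_bspline_nonpos hm (not_lt.1 hc))
  · by_contra hc
    exact h (aux_bspline_ge (not_lt.1 hc))

/-- The cell of level `K` with integer index `l`. -/
def cellK {d : ℕ} (K : ℕ) (l : Fin d → ℤ) : Set (Euc d) :=
  {x | ∀ i, (l i : ℝ) ≤ 2 ^ K * x i ∧ 2 ^ K * x i < l i + 1}

lemma aux_touch {d m : ℕ} (hm : 1 ≤ m) {k K : ℕ} (hk : K ≤ k) (j : Fin d → ℤ)
    (V : Finset (Fin d → ℤ)) (hV : ∀ l ∈ V, ∃ x ∈ cellK K l, Mspline d m k j x ≠ 0) :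
    V.card ≤ (m + 2) ^ d := by
  obtain ⟨e, rfl⟩ := Nat.exists_eq_add_of_le hk
  have hsub : V ⊆ Fintype.piFinset (fun i : Fin d =>
      Finset.Icc ⌊(j i : ℝ) / 2 ^ e⌋ (⌊(j i : ℝ) / 2 ^ e⌋ + (m + 1))) := by
    intro l hl
    obtain ⟨x, hx, hx0⟩ := hV l hl
    rw [Fintype.mem_piFinset]
    intro i
    obtain ⟨h1, h2⟩ := aux_M_support hm _ j x hx0 i
    obtain ⟨h3, h4⟩ := hx i
    have he : (1 : ℝ) ≤ 2 ^ e := one_le_pow₀ (by norm_num)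
    have he0 : (0 : ℝ) < 2 ^ e := by positivity
    have h5 : (j i : ℝ) / 2 ^ e < 2 ^ K * x i := by
      rw [div_lt_iff₀ he0]
      rw [pow_add] at h1
      linarith
    have h6 : 2 ^ K * x i < (j i : ℝ) / 2 ^ e + (m + 1) := by
      have : 2 ^ K * x i - (j i : ℝ) / 2 ^ e < (m + 1) / 2 ^ e := by
        rw [lt_div_iff₀ he0, sub_mul, div_mul_cancel₀ _ he0.ne']
        rw [pow_add] at h2
        linarith
      have h7 : ((m : ℝ) + 1) / 2 ^ e ≤ m + 1 := div_le_self (by positivity) he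
      linarith
    rw [Finset.mem_Icc]
    constructor
    · have : ⌊(j i : ℝ) / 2 ^ e⌋ < l i + 1 := by
        rw [Int.floor_lt]; push_cast; linarith
      omega
    · have : l i - (m + 1) ≤ ⌊(j i : ℝ) / 2 ^ e⌋ := by
        rw [Int.le_floor]; push_cast; linarith
      linarith
  refine (Finset.card_le_card hsub).trans ?_
  rw [Fintype.card_piFinset]
  rw [Finset.prod_congr rfl (g := fun _ => m + 2)]
  · simp
  · intro i _
    rw [Int.card_Icc]
    omega

lemma aux_M_cont (d m k : ℕ) (j : Fin d → ℤ) : Continuous (Mspline d m k j) := by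
  unfold Mspline bspline
  fun_prop

lemma aux_core {d m : ℕ} (i0 : Fin d) (K : ℕ) (l : Fin d → ℤ)
    (f S : Euc d → ℝ) (A h : ℝ) (hA : 0 < A) (hh : 0 < h)
    (hKh : 2 ^ K * ((m + 2) * h) ≤ 1 / 2)
    (hf : ∀ x ∈ cellK K l, f x = A * Real.cos (Real.pi / h * x i0))
    (hS : ∀ x : Euc d, x ∈ cellK K l →
      x + (((m + 1 : ℕ) : ℝ) * h) • EuclideanSpace.single i0 (1 : ℝ) ∈ cellK K l →
      ∑ i ∈ Finset.range (m + 2), (-1 : ℝ) ^ i * ((m + 1).choose i : ℝ) *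
      S (x + ((i : ℝ) * h) • EuclideanSpace.single i0 (1 : ℝ)) = 0)
    (x : Euc d) (hx : x ∈ cellK K l) (hx2 : 2 ^ K * x i0 < l i0 + 1 / 2) :
    ∃ s < 2 * (m + 2), x + ((s : ℝ) * (h / 2)) • EuclideanSpace.single i0 (1 : ℝ) ∈ cellK K l ∧
      A / 2 ≤ |f (x + ((s : ℝ) * (h / 2)) • EuclideanSpace.single i0 (1 : ℝ)) -
        S (x + ((s : ℝ) * (h / 2)) • EuclideanSpace.single i0 (1 : ℝ))| := by
  set e0 : Euc d := EuclideanSpace.single i0 (1 : ℝ) with he0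
  have hK : (0 : ℝ) < 2 ^ K := by positivity
  have hcell : ∀ τ : ℝ, 0 ≤ τ → τ ≤ (m + 2) * h → x + τ • e0 ∈ cellK K l := by
    intro τ h0 h1 i
    rw [aux_add_single]
    obtain ⟨a, b⟩ := hx i
    split_ifs with hi
    · subst hi
      have : 2 ^ K * τ ≤ 1 / 2 := le_trans (by gcongr) hKh
      have : 0 ≤ 2 ^ K * τ := by positivity
      constructor <;> rw [mul_add] <;> linarith
    · exact ⟨a, b⟩
  by_contra hcon
  push Not at hcon
  have key : ∀ e : ℕ, e < 2 → |Real.cos (Real.pi / h * (x i0 + e * (h / 2)))| < 1 / 2 := by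
    intro e he
    have heR : (e : ℝ) ≤ 1 := by exact_mod_cast (by omega : e ≤ 1)
    set y : Euc d := x + ((e : ℝ) * (h / 2)) • e0 with hy
    have hyi : y i0 = x i0 + e * (h / 2) := by rw [hy, aux_add_single, if_pos rfl]
    have hys : ∀ i : ℕ, y + ((i : ℝ) * h) • e0 = x + (((2 * i + e : ℕ) : ℝ) * (h / 2)) • e0 := by
      intro i
      rw [hy, add_assoc, ← add_smul]; congr 2; push_cast; ring
    have hmem : ∀ i < m + 2, y + ((i : ℝ) * h) • e0 ∈ cellK K l := by
      intro i hi
      rw [hys]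
      refine hcell _ (by positivity) ?_
      have : (i : ℝ) ≤ m + 1 := by exact_mod_cast (by omega : i ≤ m + 1)
      push_cast
      nlinarith
    have hlt : ∀ i < m + 2, |f (y + ((i : ℝ) * h) • e0) - S (y + ((i : ℝ) * h) • e0)| < A / 2 := by
      intro i hi
      have hm := hmem i hi
      rw [hys] at hm ⊢
      exact hcon _ (by omega) hm
    have hSy := hS y (by simpa using hmem 0 (by omega)) (hmem (m + 1) (by omega))
    have hsum : ∑ i ∈ Finset.range (m + 2), ((m + 1).choose i : ℝ) = 2 ^ (m + 1) := by
      exact_mod_cast Nat.sum_range_choose (m + 1)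
    have hfy : ∑ i ∈ Finset.range (m + 2), (-1 : ℝ) ^ i * ((m + 1).choose i : ℝ) *
        f (y + ((i : ℝ) * h) • e0) = 2 ^ (m + 1) * (A * Real.cos (Real.pi / h * y i0)) := by
      rw [← hsum, Finset.sum_mul]
      refine Finset.sum_congr rfl fun i hi => ?_
      rw [hf _ (hmem i (Finset.mem_range.1 hi)), aux_add_single, if_pos rfl]
      have : Real.pi / h * (y i0 + i * h) = Real.pi / h * y i0 + i * Real.pi := by
        field_simp
      rw [this, Real.cos_add_nat_mul_pi]
      have h1 : (-1 : ℝ) ^ i * (-1 : ℝ) ^ i = 1 := by rw [← mul_pow]; simp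
      linear_combination ((m + 1).choose i : ℝ) * A * Real.cos (Real.pi / h * y i0) * h1
    have hdiff : |2 ^ (m + 1) * (A * Real.cos (Real.pi / h * y i0))| < 2 ^ (m + 1) * (A / 2) := by
      rw [← hfy, ← sub_zero (Finset.sum _ _), ← hSy, ← Finset.sum_sub_distrib]
      refine (Finset.abs_sum_le_sum_abs _ _).trans_lt ?_
      rw [← hsum, Finset.sum_mul]
      refine Finset.sum_lt_sum_of_nonempty ⟨0, by simp⟩ fun i hi => ?_
      have hi' := Finset.mem_range.1 hi
      rw [← mul_sub, abs_mul, abs_mul, abs_pow, abs_neg, abs_one, one_pow, one_mul, Nat.abs_cast]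
      have : (0 : ℝ) < ((m + 1).choose i : ℝ) := by
        exact_mod_cast Nat.choose_pos (by omega)
      exact mul_lt_mul_of_pos_left (hlt i hi') this
    rw [abs_mul, abs_mul, abs_of_pos hA, abs_of_pos (by positivity)] at hdiff
    have h3 := lt_of_mul_lt_mul_left hdiff (by positivity)
    rw [hyi] at h3
    have h4 : A * |Real.cos (Real.pi / h * (x i0 + e * (h / 2)))| < A * (1 / 2) := by linarith
    exact lt_of_mul_lt_mul_left h4 hA.le
  have k0 := key 0 (by omega)
  have k1 := key 1 (by omega)
  have e1 : Real.pi / h * (x i0 + ((1 : ℕ) : ℝ) * (h / 2)) = Real.pi / h * x i0 + Real.pi / 2 := by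
    push_cast; field_simp
  rw [e1, Real.cos_add_pi_div_two, abs_neg] at k1
  have e2 : Real.pi / h * (x i0 + ((0 : ℕ) : ℝ) * (h / 2)) = Real.pi / h * x i0 := by
    push_cast; ring
  rw [e2] at k0
  have := Real.sin_sq_add_cos_sq (Real.pi / h * x i0)
  rw [abs_lt] at k0 k1
  nlinarith

/-- Lower half (in direction `i0`) of a cell. -/
def halfCell {d : ℕ} (i0 : Fin d) (K : ℕ) (l : Fin d → ℤ) : Set (Euc d) :=
  {x | x ∈ cellK K l ∧ 2 ^ K * x i0 < l i0 + 1 / 2}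

lemma aux_half_eq {d : ℕ} (i0 : Fin d) (K : ℕ) (l : Fin d → ℤ) :
    halfCell i0 K l = hbox (fun i => (l i : ℝ) / 2 ^ K)
      (fun i => (if i = i0 then 1 / 2 else 1) * (1 / 2 ^ K)) := by
  have hK : (0 : ℝ) < 2 ^ K := by positivity
  ext x
  have h1 : ∀ i, (l i : ℝ) / 2 ^ K ≤ x i ↔ (l i : ℝ) ≤ 2 ^ K * x i := fun i => by
    rw [div_le_iff₀ hK, mul_comm]
  have h2 : ∀ (i) (c : ℝ), x i < (l i : ℝ) / 2 ^ K + c * (1 / 2 ^ K) ↔ 2 ^ K * x i < l i + c :=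
    fun i c => by
      rw [mul_one_div, ← add_div, lt_div_iff₀ hK, mul_comm]
  constructor
  · rintro ⟨ha, hb⟩ i
    refine ⟨(h1 i).2 (ha i).1, (h2 i _).2 ?_⟩
    split_ifs with hi
    · subst hi; exact hb
    · exact (ha i).2
  · intro hx
    refine ⟨fun i => ⟨(h1 i).1 (hx i).1, ?_⟩, ?_⟩
    · have := (h2 i _).1 (hx i).2
      split_ifs at this <;> linarith
    · have := (h2 i0 _).1 (hx i0).2
      rwa [if_pos rfl] at this

lemma aux_half_vol {d : ℕ} (i0 : Fin d) (K : ℕ) (l : Fin d → ℤ) :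
    volume (halfCell i0 K l) = ENNReal.ofReal (1 / 2 * (1 / 2 ^ K) ^ d) := by
  rw [aux_half_eq, aux_hbox_vol, ← ENNReal.ofReal_prod_of_nonneg, Finset.prod_mul_distrib]
  · simp
  · intro i _
    split_ifs <;> positivity

lemma aux_half_disj {d : ℕ} (i0 : Fin d) (K : ℕ) {l l' : Fin d → ℤ} (h : l ≠ l') :
    Disjoint (halfCell i0 K l) (halfCell i0 K l') := by
  rw [Set.disjoint_left]
  intro x hx hx'
  apply h
  funext i
  obtain ⟨a, b⟩ := hx.1 i
  obtain ⟨a', b'⟩ := hx'.1 i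
  have h1 : (l i : ℝ) < l' i + 1 := by linarith
  have h2 : (l' i : ℝ) < l i + 1 := by linarith
  have h1' : l i < l' i + 1 := by exact_mod_cast h1
  have h2' : l' i < l i + 1 := by exact_mod_cast h2
  omega

lemma aux_lower {d m : ℕ} (hm : 1 ≤ m) (i0 : Fin d) (k0 n N : ℕ) (J : Fin d → ℤ)
    (hn : 2 * (N * (m + 2) ^ d) ≤ (2 ^ n) ^ d)
    (f : Euc d → ℝ) (A h : ℝ) (hA : 0 < A) (hh : 0 < h)
    (hKh : 2 ^ (k0 + n) * ((m + 2) * h) ≤ 1 / 2)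
    (hQ : ∀ x : Euc d, (∀ i, (J i : ℝ) ≤ 2 ^ k0 * x i ∧ 2 ^ k0 * x i ≤ J i + 1) →
      x ∈ unitCube d ∧ f x = A * Real.cos (Real.pi / h * x i0))
    (g : Fin N → Euc d → ℝ) (hg : ∀ i, g i ∈ splineDict d m) (a : Fin N → ℝ) :
    ENNReal.ofReal (1 / (8 * (m + 2) * (2 ^ k0) ^ d)) ≤
      cubeMeasure d {x | A / 2 ≤ |f x - ∑ i, a i * g i x|} := by
  set K := k0 + n with hK
  choose k j hgk _ using hg
  set V : Finset (Fin d → ℤ) :=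
    Fintype.piFinset fun i => Finset.Ico (2 ^ n * J i) (2 ^ n * J i + 2 ^ n) with hV
  have hVc : V.card = (2 ^ n) ^ d := by
    rw [hV, Fintype.card_piFinset, Finset.prod_congr rfl (g := fun _ => 2 ^ n)]
    · simp
    · intro i _
      rw [Int.card_Ico, add_sub_cancel_left]
      exact_mod_cast Int.toNat_natCast (2 ^ n)
  have hcellQ : ∀ l ∈ V, ∀ x ∈ cellK K l,
      (∀ i, (J i : ℝ) ≤ 2 ^ k0 * x i ∧ 2 ^ k0 * x i ≤ J i + 1) := by
    intro l hl x hx i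
    have hli := Finset.mem_Ico.1 (Fintype.mem_piFinset.1 hl i)
    obtain ⟨p1, p2⟩ := hx i
    have h1 : (2 : ℝ) ^ n * J i ≤ l i := by exact_mod_cast hli.1
    have h2 : (l i : ℝ) + 1 ≤ 2 ^ n * J i + 2 ^ n := by
      exact_mod_cast (by have := hli.2; omega : l i + 1 ≤ 2 ^ n * J i + 2 ^ n)
    have hn0 : (0 : ℝ) < 2 ^ n := by positivity
    rw [hK, pow_add] at p1 p2
    constructor
    · refine le_of_mul_le_mul_left ?_ hn0
      linarith
    · refine le_of_mul_le_mul_left ?_ hn0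
      linarith
  set bad : Fin N → Finset (Fin d → ℤ) := fun i =>
    if K < k i then V.filter (fun l => ∃ x ∈ cellK K l, Mspline d m (k i) (j i) x ≠ 0) else ∅
    with hbad
  have hbadc : ∀ i, (bad i).card ≤ (m + 2) ^ d := by
    intro i
    simp only [hbad]
    split_ifs with hi
    · exact aux_touch hm hi.le (j i) _ fun l hl => (Finset.mem_filter.1 hl).2
    · simp
  set G : Finset (Fin d → ℤ) := V \ Finset.univ.biUnion bad with hG
  have hGc : (2 ^ n) ^ d ≤ 2 * G.card := by
    have h1 : (Finset.univ.biUnion bad).card ≤ N * (m + 2) ^ d := by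
      refine (Finset.card_biUnion_le).trans ?_
      refine (Finset.sum_le_card_nsmul _ _ _ fun i _ => hbadc i).trans ?_
      simp
    have h2 := Finset.le_card_sdiff (Finset.univ.biUnion bad) V
    rw [← hG] at h2
    omega
  set S : Euc d → ℝ := fun x => ∑ i, a i * g i x with hS
  set B : Set (Euc d) := {x | A / 2 ≤ |f x - S x|} ∩ unitCube d with hB
  have hcm : cubeMeasure d {x | A / 2 ≤ |f x - S x|} = volume B := by
    unfold cubeMeasure
    rw [Measure.restrict_apply' (aux_cube_meas d)]
  have hE : volume (⋃ l ∈ G, halfCell i0 K l) =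
      G.card * ENNReal.ofReal (1 / 2 * (1 / 2 ^ K) ^ d) := by
    rw [measure_biUnion_finset]
    · simp [aux_half_vol]
    · intro l _ l' _ hne
      exact aux_half_disj i0 K hne
    · intro l _
      rw [aux_half_eq]
      exact aux_hbox_meas _ _
  have hsh := aux_shift (⋃ l ∈ G, halfCell i0 K l) B (2 * (m + 2))
    (fun s => ((s : ℝ) * (h / 2)) • EuclideanSpace.single i0 (1 : ℝ)) (by
      intro x hx
      simp only [Set.mem_iUnion] at hx
      obtain ⟨l, hl, hxl⟩ := hx
      have hlV : l ∈ V := (Finset.mem_sdiff.1 hl).1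
      have hlB : ∀ i, l ∉ bad i := fun i hi =>
        (Finset.mem_sdiff.1 hl).2 (Finset.mem_biUnion.2 ⟨i, Finset.mem_univ i, hi⟩)
      obtain ⟨s, hs, hs1, hs2⟩ := aux_core (m := m) i0 K l f S A h hA hh hKh
        (fun y hy => (hQ y (hcellQ l hlV y hy)).2) (by
          intro y hy hy2
          have hin : ∀ i < m + 2, y + ((i : ℝ) * h) • EuclideanSpace.single i0 (1 : ℝ)
              ∈ cellK K l := by
            intro i hi c
            obtain ⟨q1, q2⟩ := hy c
            obtain ⟨q3, q4⟩ := hy2 c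
            rw [aux_add_single] at q3 q4 ⊢
            split_ifs at q3 q4 ⊢ with hc
            · have hi' : (i : ℝ) ≤ ((m + 1 : ℕ) : ℝ) := by exact_mod_cast (by omega : i ≤ m + 1)
              have hK0 : (0 : ℝ) < 2 ^ K := by positivity
              constructor
              · refine q1.trans ?_
                gcongr
                have : 0 ≤ (i : ℝ) * h := by positivity
                linarith
              · refine lt_of_le_of_lt ?_ q4
                gcongr
            · exact ⟨q1, q2⟩
          simp only [hS, Finset.mul_sum]
          rw [Finset.sum_comm]
          refine Finset.sum_eq_zero fun i _ => ?_
          have hz : ∑ i' ∈ Finset.range (m + 2), (-1 : ℝ) ^ i' * ((m + 1).choose i' : ℝ) *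
              g i (y + ((i' : ℝ) * h) • EuclideanSpace.single i0 (1 : ℝ)) = 0 := by
            rw [hgk i]
            by_cases hki : K < k i
            · refine Finset.sum_eq_zero fun i' hi' => ?_
              have : Mspline d m (k i) (j i)
                  (y + ((i' : ℝ) * h) • EuclideanSpace.single i0 (1 : ℝ)) = 0 := by
                by_contra hne
                apply hlB i
                simp only [hbad, if_pos hki]
                exact Finset.mem_filter.2 ⟨hlV, _, hin i' (Finset.mem_range.1 hi'), hne⟩
              rw [this, mul_zero]
            · refine aux_M_diff hm i0 (not_lt.1 hki) (l i0) (j i) y h hh.le (hy i0).1 ?_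
              have := (hy2 i0).2
              rw [aux_add_single, if_pos rfl] at this
              push_cast at this
              exact this.le
          calc _ = a i * ∑ i' ∈ Finset.range (m + 2), (-1 : ℝ) ^ i' * ((m + 1).choose i' : ℝ) *
              g i (y + ((i' : ℝ) * h) • EuclideanSpace.single i0 (1 : ℝ)) := by
                rw [Finset.mul_sum]; refine Finset.sum_congr rfl fun i' _ => ?_; ring
            _ = 0 := by rw [hz, mul_zero]) x hxl.1 hxl.2
      exact ⟨s, hs, hs2, (hQ _ (hcellQ l hlV _ hs1)).1⟩)
  rw [hcm]
  rw [hE] at hsh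
  have hM : ((2 * (m + 2) : ℕ) : ℝ≥0∞) = ENNReal.ofReal (2 * (m + 2)) := by
    rw [← ENNReal.ofReal_natCast]; push_cast; rfl
  have hle : ENNReal.ofReal (2 * (m + 2)) * ENNReal.ofReal (1 / (8 * (m + 2) * (2 ^ k0) ^ d)) ≤
      ENNReal.ofReal (2 * (m + 2)) * volume B := by
    rw [← hM]
    refine le_trans ?_ hsh
    rw [hM, ← ENNReal.ofReal_mul (by positivity), ← ENNReal.ofReal_natCast G.card,
      ← ENNReal.ofReal_mul (by positivity)]
    refine ENNReal.ofReal_le_ofReal ?_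
    have hGr : ((2 : ℝ) ^ n) ^ d ≤ 2 * G.card := by exact_mod_cast hGc
    have e1 : (2 * ((m : ℝ) + 2)) * (1 / (8 * (m + 2) * (2 ^ k0) ^ d)) =
        (((2 : ℝ) ^ n) ^ d / 2) * (1 / 2 * (1 / 2 ^ K) ^ d) := by
      rw [hK, pow_add, div_pow, mul_pow]
      field_simp
      norm_num
    rw [e1]
    gcongr
    linarith
  have hpos : ENNReal.ofReal (2 * ((m : ℝ) + 2)) ≠ 0 := by
    rw [Ne, ENNReal.ofReal_eq_zero, not_le]; positivity
  exact (ENNReal.mul_le_mul_iff_right hpos ENNReal.ofReal_ne_top).1 hle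

lemma aux_norm_le {d : ℕ} (x : Euc d) (t : ℝ) (ht : 0 ≤ t) (h : ∀ i, |x i| ≤ t) :
    ‖x‖ ≤ d * t := by
  rw [EuclideanSpace.norm_eq]
  apply Real.sqrt_le_iff.2
  refine ⟨by positivity, ?_⟩
  calc ∑ i, ‖x i‖ ^ 2 ≤ ∑ _i : Fin d, t ^ 2 := by
        refine Finset.sum_le_sum fun i _ => ?_
        rw [Real.norm_eq_abs]
        exact pow_le_pow_left₀ (abs_nonneg _) (h i) 2
    _ = d * t ^ 2 := by simp
    _ ≤ (d * t) ^ 2 := by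
        rcases Nat.eq_zero_or_pos d with h0 | h0
        · subst h0; simp
        · have : (1 : ℝ) ≤ d := by exact_mod_cast h0
          rw [mul_pow]
          refine mul_le_mul_of_nonneg_right ?_ (sq_nonneg t)
          nlinarith

lemma aux_clog (d N : ℕ) (hd : 1 ≤ d) (hN : 1 ≤ N) :
    ∃ n2 : ℕ, N ≤ (2 ^ n2) ^ d ∧ (2 ^ n2) ^ d ≤ 2 ^ d * N := by
  have hb : 1 < 2 ^ d := Nat.one_lt_two_pow (by omega)
  refine ⟨Nat.clog (2 ^ d) N, ?_, ?_⟩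
  · rw [← pow_mul, mul_comm, pow_mul]
    exact Nat.le_pow_clog hb N
  · rw [← pow_mul, mul_comm (Nat.clog _ _), pow_mul]
    rcases Nat.lt_or_ge 1 N with h1 | h1
    · have h2 := Nat.pow_pred_clog_lt_self hb h1
      have h3 : 0 < Nat.clog (2 ^ d) N := Nat.clog_pos hb h1
      obtain ⟨k, hk⟩ := Nat.exists_eq_succ_of_ne_zero h3.ne'
      rw [hk] at h2 ⊢
      rw [pow_succ, mul_comm]
      exact Nat.mul_le_mul_left _ h2.le
    · have : N = 1 := by omega
      subst this
      simp
      exact Nat.one_le_two_pow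

lemma aux_choose_cube {d : ℕ} (x0 : Euc d) (hx0 : x0 ∈ unitCube d) (k0 : ℕ) :
    ∃ J : Fin d → ℤ, ∀ x : Euc d,
      (∀ i, (J i : ℝ) ≤ 2 ^ k0 * x i ∧ 2 ^ k0 * x i ≤ J i + 1) →
      x ∈ unitCube d ∧ ‖x - x0‖ ≤ d * (1 / 2 ^ k0) := by
  refine ⟨fun i => min ⌊2 ^ k0 * x0 i⌋ (2 ^ k0 - 1), ?_⟩
  intro x hx
  have hp : (0 : ℝ) < 2 ^ k0 := by positivity
  have hJ : ∀ i, (0 : ℝ) ≤ ((min ⌊2 ^ k0 * x0 i⌋ (2 ^ k0 - 1) : ℤ) : ℝ) ∧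
      ((min ⌊2 ^ k0 * x0 i⌋ (2 ^ k0 - 1) : ℤ) : ℝ) + 1 ≤ 2 ^ k0 ∧
      ((min ⌊2 ^ k0 * x0 i⌋ (2 ^ k0 - 1) : ℤ) : ℝ) ≤ 2 ^ k0 * x0 i ∧
      2 ^ k0 * x0 i ≤ ((min ⌊2 ^ k0 * x0 i⌋ (2 ^ k0 - 1) : ℤ) : ℝ) + 1 := by
    intro i
    obtain ⟨a1, a2⟩ := hx0 i
    have f1 : (0 : ℤ) ≤ ⌊2 ^ k0 * x0 i⌋ := Int.floor_nonneg.2 (by positivity)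
    have f2 := Int.floor_le (2 ^ k0 * x0 i)
    have f3 := Int.lt_floor_add_one (2 ^ k0 * x0 i)
    have f4 : (1 : ℤ) ≤ 2 ^ k0 := one_le_pow₀ (by norm_num)
    have f5 : 2 ^ k0 * x0 i ≤ 2 ^ k0 := mul_le_of_le_one_right hp.le a2
    refine ⟨?_, ?_, ?_, ?_⟩
    · have : (0 : ℤ) ≤ min ⌊2 ^ k0 * x0 i⌋ (2 ^ k0 - 1) := le_min f1 (by omega)
      exact_mod_cast this
    · have : min ⌊2 ^ k0 * x0 i⌋ (2 ^ k0 - 1) + 1 ≤ (2 : ℤ) ^ k0 := by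
        have := min_le_right ⌊2 ^ k0 * x0 i⌋ ((2 : ℤ) ^ k0 - 1)
        omega
      exact_mod_cast this
    · have : ((min ⌊2 ^ k0 * x0 i⌋ (2 ^ k0 - 1) : ℤ) : ℝ) ≤ (⌊2 ^ k0 * x0 i⌋ : ℝ) := by
        exact_mod_cast min_le_left _ _
      linarith
    · rcases min_choice ⌊2 ^ k0 * x0 i⌋ ((2 : ℤ) ^ k0 - 1) with h | h <;> rw [h]
      · exact f3.le
      · push_cast; linarith
  constructor
  · intro i
    obtain ⟨j1, j2, j3, j4⟩ := hJ i
    obtain ⟨b1, b2⟩ := hx i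
    constructor
    · by_contra hc
      push Not at hc
      nlinarith
    · by_contra hc
      push Not at hc
      nlinarith
  · refine aux_norm_le _ _ (by positivity) fun i => ?_
    obtain ⟨j1, j2, j3, j4⟩ := hJ i
    obtain ⟨b1, b2⟩ := hx i
    rw [le_div_iff₀ hp, ← abs_of_pos hp, ← abs_mul]
    simp only [PiLp.sub_apply]
    rw [abs_le]
    beta_reduce at b1 b2
    constructor <;> nlinarith

lemma aux_sigma {d : ℕ} (σ : Euc d → ℝ) (c : ℝ) (hc : 0 < c)
    (hl : ∀ x ∈ unitCube d, ∀ y ∈ unitCube d, x ≠ y →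
      |σ x - σ y| ≤ c / Real.log (Real.exp 1 + 1 / ‖x - y‖))
    (x0 : Euc d) (hx0 : x0 ∈ unitCube d) :
    (∀ x ∈ unitCube d, σ x ≤ σ x0 + c) ∧
    ∀ η : ℝ, 0 < η → ∀ x ∈ unitCube d, ‖x - x0‖ < Real.exp (-(c / η)) → σ x ≤ σ x0 + η := by
  constructor
  · intro x hx
    by_cases hxx : x = x0
    · subst hxx; linarith
    · have h1 := (abs_le.1 (hl x hx x0 hx0 hxx)).2
      have h2 : 1 ≤ Real.log (Real.exp 1 + 1 / ‖x - x0‖) := by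
        rw [Real.le_log_iff_exp_le (by positivity)]
        have : 0 ≤ 1 / ‖x - x0‖ := by positivity
        linarith
      have h3 : c / Real.log (Real.exp 1 + 1 / ‖x - x0‖) ≤ c := div_le_self hc.le h2
      linarith
  · intro η hη x hx hxd
    by_cases hxx : x = x0
    · subst hxx; linarith
    · have h1 := (abs_le.1 (hl x hx x0 hx0 hxx)).2
      have hpos : 0 < ‖x - x0‖ := norm_pos_iff.2 (sub_ne_zero.2 hxx)
      have h2 : c / η ≤ Real.log (Real.exp 1 + 1 / ‖x - x0‖) := by
        rw [Real.le_log_iff_exp_le (by positivity)]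
        have h4 : Real.exp (c / η) ≤ 1 / ‖x - x0‖ := by
          rw [le_div_iff₀ hpos]
          calc Real.exp (c / η) * ‖x - x0‖ ≤ Real.exp (c / η) * Real.exp (-(c / η)) := by
                gcongr
            _ = 1 := by rw [← Real.exp_add]; simp
        have := Real.exp_pos 1
        linarith
      have h3 : c / Real.log (Real.exp 1 + 1 / ‖x - x0‖) ≤ η := by
        rw [div_le_iff₀ (lt_of_lt_of_le (by positivity) h2)]
        rw [div_le_iff₀ hη] at h2
        linarith
      linarith

lemma aux_testFn_cont {d : ℕ} (i0 : Fin d) {x0 : Euc d} (χ : ContDiffBump x0) (w : ℝ) :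
    Continuous (testFn i0 χ w) := by
  unfold testFn
  have := χ.continuous
  fun_prop

lemma aux_testFn_le {d : ℕ} (i0 : Fin d) {x0 : Euc d} (χ : ContDiffBump x0) (w : ℝ) (x : Euc d) :
    |testFn i0 χ w x| ≤ 1 := by
  unfold testFn
  rw [abs_mul, abs_of_nonneg χ.nonneg]
  exact mul_le_one₀ χ.le_one (abs_nonneg _) (Real.abs_cos_le_one _)

/-- Theorem 3.5, `σ_N` part. Let `σ` be log-Hölder continuous with
attained minimum `s_min > d(1/p − 1/r)_+` on `Ω`, and let `𝐌` be the B-spline dictionary of a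
degree `m` with `sup_Ω σ < min{m, m−1+1/p}`. Then for every `ε > 0` there is `C_ε > 0` with
`σ_N(U_{B^{σ}_{p,q}(Ω)}, 𝐌)_{L^r(Ω)} ≥ C_ε N^{−(s_min+ε)/d}` for all `N ≥ 1`. -/
theorem sigmaN_lower_bound (d m : ℕ) (hd : 1 ≤ d) (hm : 1 ≤ m)
    (p q r : ℝ≥0∞) (hp : 0 < p) (hq : 0 < q) (hr : 0 < r)
    (σ : Euc d → ℝ) (hσlh : LogHolder σ)
    (hσinf : ∃ σ₀ : ℝ, 0 < σ₀ ∧ ∀ x ∈ unitCube d, σ₀ ≤ σ x)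
    (smin : ℝ) (hsmin : IsLeast (σ '' unitCube d) smin)
    (hδ : (d : ℝ) * max (1 / p.toReal - 1 / r.toReal) 0 < smin)
    (hdeg : sSup (σ '' unitCube d) < min (m : ℝ) ((m : ℝ) - 1 + 1 / p.toReal)) :
    ∀ ε : ℝ, 0 < ε → ∃ C : ℝ, 0 < C ∧ ∀ N : ℕ, 1 ≤ N →
      ENNReal.ofReal (C * (N : ℝ) ^ (-(smin + ε) / (d : ℝ))) ≤
        ⨆ f ∈ vBesovUnitBall d p q σ,
          ⨅ (g : Fin N → Euc d → ℝ) (_ : ∀ i, g i ∈ splineDict d m) (a : Fin N → ℝ),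
            eLpNorm (fun x => f x - ∑ i, a i * g i x) r (cubeMeasure d) := by
  intro ε0 hε0
  obtain ⟨c, hc, hl⟩ := hσlh
  obtain ⟨σ₀, hσ₀, hσlow⟩ := hσinf
  obtain ⟨⟨x0, hx0, hx0s⟩, hleast⟩ := hsmin
  obtain ⟨hub, hloc⟩ := aux_sigma σ c hc hl x0 hx0
  rw [hx0s] at hub hloc
  have hbdd : BddAbove (σ '' unitCube d) := by
    refine ⟨smin + c, ?_⟩
    rintro _ ⟨x, hx, rfl⟩
    exact hub x hx
  have hspos : 0 < smin := by
    have := hσlow x0 hx0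
    linarith
  have hR1 : 1 ≤ besovR σ := by unfold besovR; omega
  have hRs : smin < (besovR σ : ℝ) := by
    have h1 : smin ≤ sSup (σ '' unitCube d) := le_csSup hbdd ⟨x0, hx0, hx0s⟩
    have h2 := Nat.lt_floor_add_one (sSup (σ '' unitCube d))
    unfold besovR
    push_cast
    linarith
  set R := besovR σ with hRdef
  obtain ⟨ε, hε, hεε0, hεR⟩ : ∃ ε : ℝ, 0 < ε ∧ ε ≤ ε0 ∧ smin + ε ≤ R :=
    ⟨min ε0 (R - smin), lt_min hε0 (by linarith), min_le_left _ _, by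
      have := min_le_right ε0 (R - smin)
      linarith⟩
  obtain ⟨δ, hδpos, hδloc⟩ : ∃ δ : ℝ, 0 < δ ∧ ∀ x ∈ unitCube d, ‖x - x0‖ < δ →
      σ x ≤ smin + ε - ε / 2 := by
    refine ⟨Real.exp (-(c / (ε / 2))), Real.exp_pos _, fun x hx hxd => ?_⟩
    have := hloc (ε / 2) (by linarith) x hx hxd
    linarith
  set α := smin + ε with hα
  have hαpos : 0 < α := by linarith
  let χ : ContDiffBump x0 := ⟨δ / 4, δ / 2, by linarith, by linarith⟩
  let i0 : Fin d := ⟨0, hd⟩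
  obtain ⟨C1, hC1, hder⟩ := aux_test_deriv i0 χ R
  obtain ⟨c0, hc0, hbes⟩ := aux_besov p q hq σ x0 R hR1 α (ε / 2) δ (smin + c) C1 hαpos hεR
    (by linarith) hδpos hC1 (fun x hx => ⟨hσ₀.le.trans (hσlow x hx), hub x hx⟩) hδloc
  obtain ⟨k0, hk0⟩ := pow_unbounded_of_one_lt (4 * (d : ℝ) / δ) (one_lt_two (α := ℝ))
  obtain ⟨J, hJ⟩ := aux_choose_cube x0 hx0 k0
  have hβ : (0 : ℝ) < 1 / (8 * (m + 2) * (2 ^ k0) ^ d) := by positivity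
  obtain ⟨κ, hκ, hge⟩ := aux_eLp_ge (d := d) r hr _ hβ
  have hω : 0 < 2 * ((m : ℝ) + 2) * Real.pi := by positivity
  set D : ℝ := 2 * ((m : ℝ) + 2) * Real.pi * 2 ^ (k0 + (m + 2) + 1) with hD
  have hDpos : 0 < D := by positivity
  refine ⟨c0 / 2 * κ * D ^ (-α), by positivity, ?_⟩
  intro N hN
  have hN0 : (1 : ℝ) ≤ N := by exact_mod_cast hN
  obtain ⟨n2, hn2a, hn2b⟩ := aux_clog d N hd hN
  set n := m + 2 + n2 with hn
  set h : ℝ := 1 / (2 ^ (k0 + n) * (2 * ((m : ℝ) + 2))) with hh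
  have hhpos : 0 < h := by positivity
  set w : ℝ := Real.pi / h with hw
  have hweq : w = 2 * ((m : ℝ) + 2) * Real.pi * 2 ^ (k0 + n) := by
    rw [hw, hh]; field_simp
  have hw1 : 1 ≤ w := by
    rw [hweq]
    have e1 : (1 : ℝ) ≤ 2 ^ (k0 + n) := one_le_pow₀ (by norm_num)
    have e2 : (1 : ℝ) ≤ 2 * ((m : ℝ) + 2) * Real.pi := by
      have := Real.pi_gt_three
      have : (0 : ℝ) ≤ m := by positivity
      nlinarith
    exact one_le_mul_of_one_le_of_one_le e2 e1
  have hwpos : 0 < w := by linarith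
  -- comparison of `w` with `N ^ (1/d)`
  have hd0 : (0 : ℝ) < d := by exact_mod_cast hd
  have hn2c : (2 : ℝ) ^ n2 ≤ 2 * (N : ℝ) ^ (1 / (d : ℝ)) := by
    have e1 : ((2 : ℝ) ^ n2) ^ d ≤ (2 * (N : ℝ) ^ (1 / (d : ℝ))) ^ d := by
      rw [mul_pow, ← Real.rpow_natCast ((N : ℝ) ^ (1 / (d : ℝ))) d, ← Real.rpow_mul (by positivity),
        one_div, inv_mul_cancel₀ hd0.ne', Real.rpow_one]
      exact_mod_cast hn2b
    exact le_of_pow_le_pow_left₀ (by omega) (by positivity) e1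
  have hwle : w ≤ D * (N : ℝ) ^ (1 / (d : ℝ)) := by
    rw [hweq, hD]
    calc 2 * ((m : ℝ) + 2) * Real.pi * 2 ^ (k0 + n)
        = 2 * ((m : ℝ) + 2) * Real.pi * 2 ^ (k0 + (m + 2)) * 2 ^ n2 := by
          rw [hn]; ring
      _ ≤ 2 * ((m : ℝ) + 2) * Real.pi * 2 ^ (k0 + (m + 2)) * (2 * (N : ℝ) ^ (1 / (d : ℝ))) := by
          gcongr
      _ = _ := by ring
  have hwα : D ^ (-α) * (N : ℝ) ^ (-(smin + ε0) / (d : ℝ)) ≤ w ^ (-α) := by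
    have e1 : (D * (N : ℝ) ^ (1 / (d : ℝ))) ^ (-α) ≤ w ^ (-α) :=
      Real.rpow_le_rpow_of_nonpos hwpos hwle (by linarith)
    have e2 : (D * (N : ℝ) ^ (1 / (d : ℝ))) ^ (-α) = D ^ (-α) * (N : ℝ) ^ (-α / (d : ℝ)) := by
      rw [Real.mul_rpow hDpos.le (by positivity), ← Real.rpow_mul (by positivity)]
      congr 2; ring
    have e3 : (N : ℝ) ^ (-(smin + ε0) / (d : ℝ)) ≤ (N : ℝ) ^ (-α / (d : ℝ)) := by
      refine Real.rpow_le_rpow_of_exponent_le hN0 ?_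
      gcongr
      linarith
    rw [e2] at e1
    exact (mul_le_mul_of_nonneg_left e3 (by positivity)).trans e1
  set A : ℝ := c0 * w ^ (-α) with hA
  have hApos : 0 < A := by positivity
  have hmem : (fun x => c0 * w ^ (-α) * testFn i0 χ w x) ∈ vBesovUnitBall d p q σ := by
    change vBesovNormR p q σ (besovR σ) _ ≤ 1
    refine hbes w hw1 (testFn i0 χ w) (aux_testFn_le i0 χ w) ?_ (hder w hw1)
    intro x hx
    have : x ∈ Function.support χ := fun h0 => hx (by simp [testFn, h0])
    rw [χ.support_eq, Metric.mem_ball, dist_eq_norm] at this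
    exact this
  refine le_iSup₂_of_le _ hmem ?_
  refine le_iInf fun g => le_iInf fun hg => le_iInf fun a => ?_
  have hmeas : AEStronglyMeasurable
      (fun x => c0 * w ^ (-α) * testFn i0 χ w x - ∑ i, a i * g i x) (cubeMeasure d) := by
    refine Continuous.aestronglyMeasurable ?_
    have t1 := aux_testFn_cont i0 χ w
    have t2 : ∀ i, Continuous (g i) := by
      intro i
      obtain ⟨k, j, hgi, -⟩ := hg i
      rw [hgi]; exact aux_M_cont d m k j
    fun_prop
  have hcard : 2 * (N * (m + 2) ^ d) ≤ (2 ^ n) ^ d := by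
    have e1 : 2 * (m + 2) ≤ 2 ^ (m + 2) := by
      have : m + 1 < 2 ^ (m + 1) := Nat.lt_two_pow_self
      rw [pow_succ]; omega
    have e2 : 2 ≤ 2 ^ d := by
      calc 2 = 2 ^ 1 := rfl
        _ ≤ 2 ^ d := Nat.pow_le_pow_right (by norm_num) hd
    calc 2 * (N * (m + 2) ^ d) = (2 * (m + 2) ^ d) * N := by ring
      _ ≤ (2 ^ d * (m + 2) ^ d) * (2 ^ n2) ^ d := by gcongr
      _ = (2 * (m + 2)) ^ d * (2 ^ n2) ^ d := by rw [mul_pow]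
      _ ≤ (2 ^ (m + 2)) ^ d * (2 ^ n2) ^ d := by gcongr
      _ = (2 ^ n) ^ d := by rw [hn, ← mul_pow, ← pow_add]
  have hlow := aux_lower hm i0 k0 n N J hcard (fun x => c0 * w ^ (-α) * testFn i0 χ w x) A h
    hApos hhpos (by rw [hh]; field_simp; norm_num) (by
      intro x hx
      obtain ⟨u1, u2⟩ := hJ x hx
      refine ⟨u1, ?_⟩
      have h4 : (d : ℝ) * (1 / 2 ^ k0) ≤ δ / 4 := by
        rw [div_lt_iff₀ hδpos] at hk0
        rw [mul_one_div, div_le_iff₀ (by positivity)]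
        linarith
      have : χ x = 1 := by
        apply χ.one_of_mem_closedBall
        rw [Metric.mem_closedBall, dist_eq_norm]
        exact u2.trans h4
      simp only [testFn, this, one_mul]
      rfl) g hg a
  refine le_trans ?_ (hge (A / 2) _ (by positivity) hmeas hlow)
  apply ENNReal.ofReal_le_ofReal
  calc c0 / 2 * κ * D ^ (-α) * (N : ℝ) ^ (-(smin + ε0) / (d : ℝ))
      = c0 / 2 * κ * (D ^ (-α) * (N : ℝ) ^ (-(smin + ε0) / (d : ℝ))) := by ring
    _ ≤ c0 / 2 * κ * w ^ (-α) := by gcongr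
    _ = A / 2 * κ := by rw [hA]; ring
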